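/- arXiv:1804.09155 — 2 statements merged into one kernel-verified Lean document; each statement's English description precedes it below -/
import Mathlib

section
/- Let G = (V,E) be a connected finite simple graph, let s,t ∈ V, and let F ⊆ E with |F| = f be a feedback edge set, i.e. the graph G−F contains no cycle. Suppose that every vertex of G of degree at most one belongs to {s,t}, and that for every vertex v ∉ {s,t} of degree exactly two, the two neighbors of v are adjacent in G. Then |V| ≤ 5f+2 and |E| ≤ 6f+2. -/
namespace SimpleGraph

variable {V : Type*} {G : SimpleGraph V}

lemma IsAcyclic.card_edgeFinset_lt [Fintype V] [Nonempty V] [Fintype G.edgeSet]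
    (hG : G.IsAcyclic) : G.edgeFinset.card < Fintype.card V := by
  classical
  obtain ⟨T, hGT, -, hT⟩ := connected_top.exists_isTree_le_of_le_of_isAcyclic le_top hG
  have hcard := hT.card_edgeFinset
  have hle := Finset.card_le_card (edgeFinset_mono hGT)
  omega

lemma IsAcyclic.not_adj_of_adj_of_adj (hG : G.IsAcyclic) {v a b : V} (ha : G.Adj v a)
    (hb : G.Adj v b) : ¬ G.Adj a b := by
  classical
  intro hab
  exact hG.cliqueFree le_rfl {v, a, b} (is3Clique_triple_iff.mpr ⟨ha, hb, hab⟩)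

lemma IsAcyclic.eq_of_common_neighbors (hG : G.IsAcyclic) {u v a b : V} (hab : a ≠ b)
    (hua : G.Adj u a) (hub : G.Adj u b) (hva : G.Adj v a) (hvb : G.Adj v b) : u = v := by
  have hp : (Walk.cons hua.symm (Walk.cons hub Walk.nil)).IsPath := by
    simp [hab, hua.ne', hub.ne]
  have hq : (Walk.cons hva.symm (Walk.cons hvb Walk.nil)).IsPath := by
    simp [hab, hva.ne', hvb.ne]
  have h := congrArg (fun p : G.Path a b => (p : G.Walk a b).snd)
    ((hG.subsingleton_path a b).elim ⟨_, hp⟩ ⟨_, hq⟩)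
  simpa using h

lemma card_edgeFinset_lt_card_add_of_isAcyclic_deleteEdges [Fintype V] [DecidableEq V]
    [Nonempty V] [Fintype G.edgeSet] (F : Finset (Sym2 V))
    (hF : (G.deleteEdges ↑F).IsAcyclic) : G.edgeFinset.card < Fintype.card V + F.card := by
  classical
  have hlt := hF.card_edgeFinset_lt
  rw [edgeFinset_deleteEdges] at hlt
  have hle := Finset.card_le_card_sdiff_add_card (s := G.edgeFinset) (t := F)
  omega

/-- If each vertex of `B` has two adjacent neighbors, then a feedback edge set `F` has at
least `|B| / 3` edges: an edge of `F` serves its two endpoints and at most one further vertex. -/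
lemma card_le_three_mul_of_isAcyclic_deleteEdges [DecidableEq V] (F : Finset (Sym2 V))
    (hF : (G.deleteEdges ↑F).IsAcyclic) (B : Finset V)
    (hB : ∀ v ∈ B, ∃ a b, G.Adj v a ∧ G.Adj v b ∧ G.Adj a b) : B.card ≤ 3 * F.card := by
  classical
  set U := F.biUnion Sym2.toFinset with hU
  have hUcard : U.card ≤ F.card * 2 := by
    refine Finset.card_biUnion_le_card_mul _ _ _ fun e _ => ?_
    rw [Sym2.card_toFinset]
    split_ifs <;> omega
  have hex : ∀ v : V, ∃ e : Sym2 V, v ∈ B \ U → e ∈ F ∧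
      ∃ a b, a ≠ b ∧ e = s(a, b) ∧ (G.deleteEdges ↑F).Adj v a ∧ (G.deleteEdges ↑F).Adj v b := by
    intro v
    by_cases hv : v ∈ B \ U
    · obtain ⟨hvB, hvU⟩ := Finset.mem_sdiff.mp hv
      have hkeep : ∀ w, G.Adj v w → (G.deleteEdges ↑F).Adj v w := by
        intro w hw
        refine deleteEdges_adj.mpr ⟨hw, fun hmem => hvU ?_⟩
        exact Finset.mem_biUnion.mpr ⟨s(v, w), hmem, by simp⟩
      obtain ⟨a, b, ha, hb, hab⟩ := hB v hvB
      refine ⟨s(a, b), fun _ => ⟨?_, a, b, hab.ne, rfl, hkeep a ha, hkeep b hb⟩⟩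
      by_contra hmem
      exact hF.not_adj_of_adj_of_adj (hkeep a ha) (hkeep b hb)
        (deleteEdges_adj.mpr ⟨hab, hmem⟩)
    · exact ⟨s(v, v), fun h => absurd h hv⟩
  choose g hg using hex
  have hinj : (B \ U).card ≤ F.card := by
    refine Finset.card_le_card_of_injOn g (fun v hv => (hg v hv).1) fun u hu v hv huv => ?_
    obtain ⟨-, a, b, hab, hgu, hua, hub⟩ := hg u hu
    obtain ⟨-, c, d, -, hgv, hvc, hvd⟩ := hg v hv
    rw [hgu, hgv, Sym2.eq_iff] at huv
    obtain ⟨rfl, rfl⟩ | ⟨rfl, rfl⟩ := huv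
    · exact hF.eq_of_common_neighbors hab hua hub hvc hvd
    · exact hF.eq_of_common_neighbors hab hua hub hvd hvc
  have hsplit := Finset.card_le_card_sdiff_add_card (s := B) (t := U)
  omega

end SimpleGraph


/-- **Linear kernel bound for the parameter feedback edge set number.**
Let `G` be a connected finite simple graph, `s t` vertices and `F` a feedback
edge set of size `f` (i.e. `G − F` is acyclic). If every vertex of degree at
most one is `s` or `t`, and for every vertex `v ∉ {s,t}` of degree exactly two
the two neighbors of `v` are adjacent, then `|V| ≤ 5f + 2` and `|E| ≤ 6f + 2`. -/
theorem stmt2 {V : Type*} [Fintype V] [DecidableEq V] (G : SimpleGraph V)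
    [DecidableRel G.Adj] (hconn : G.Connected) (s t : V)
    (F : Finset (Sym2 V)) (hF : ↑F ⊆ G.edgeSet)
    (hacyc : (G.deleteEdges ↑F).IsAcyclic)
    (hdeg1 : ∀ v : V, G.degree v ≤ 1 → v = s ∨ v = t)
    (hdeg2 : ∀ v : V, v ≠ s → v ≠ t → G.degree v = 2 →
      ∀ a b : V, G.Adj v a → G.Adj v b → a ≠ b → G.Adj a b) :
    Fintype.card V ≤ 5 * F.card + 2 ∧ G.edgeFinset.card ≤ 6 * F.card + 2 := by
  have : Nonempty V := hconn.nonempty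
  have hedge := SimpleGraph.card_edgeFinset_lt_card_add_of_isAcyclic_deleteEdges F hacyc
  suffices hV : Fintype.card V ≤ 5 * F.card + 2 by omega
  rcases subsingleton_or_nontrivial V with _ | _
  · have := Fintype.card_le_one_iff_subsingleton.mpr ‹Subsingleton V›
    omega
  set B := Finset.univ.filter fun v : V => v ≠ s ∧ v ≠ t ∧ G.degree v = 2 with hB
  have hBcard : B.card ≤ 3 * F.card := by
    refine SimpleGraph.card_le_three_mul_of_isAcyclic_deleteEdges F hacyc B fun v hv => ?_
    obtain ⟨hvs, hvt, hv2⟩ := (Finset.mem_filter.mp hv).2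
    obtain ⟨a, b, hab, hN⟩ := Finset.card_eq_two.mp hv2
    have ha : G.Adj v a := by simp [← SimpleGraph.mem_neighborFinset, hN]
    have hb : G.Adj v b := by simp [← SimpleGraph.mem_neighborFinset, hN]
    exact ⟨a, b, ha, hb, hdeg2 v hvs hvt hv2 a b ha hb hab⟩
  have hpoint : ∀ v ∈ Finset.univ, 3 ≤ G.degree v + (if v ∈ B then 1 else 0) +
      (if v = s then 2 else 0) + (if v = t then 2 else 0) := by
    intro v _
    have hpos := hconn.preconnected.degree_pos_of_nontrivial v
    have hlow := hdeg1 v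
    have hmem : v ∈ B ↔ v ≠ s ∧ v ≠ t ∧ G.degree v = 2 := by simp [hB]
    grind
  have hsum := Finset.sum_le_sum hpoint
  simp only [Finset.sum_add_distrib, G.sum_degrees_eq_twice_card_edges, Finset.sum_const,
    Finset.card_univ, smul_eq_mul, Finset.sum_ite_mem, Finset.univ_inter, Finset.sum_ite_eq',
    Finset.mem_univ, if_true] at hsum
  omega
end

section
/- Let G = (V,E) be a finite simple graph with unit-length edges and let s,t ∈ V. Let G' be the 1-subdivision of G: its vertex set is V ⊎ E, a vertex v ∈ V and an edge-vertex e ∈ E are adjacent in G' if and only if v is an endpoint of e, and there are no other adjacencies. Then for all k,ℓ ∈ ℕ: there exists S ⊆ E with |S| ≤ k and dist_{G−S}(s,t) ≥ ℓ if and only if there exists S' ⊆ E(G') with |S'| ≤ k and dist_{G'−S'}(s,t) ≥ 2ℓ. -/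
/-- The relation generating the 1-subdivision of `G`: a vertex `v ∈ V` and an
edge-vertex `e ∈ E` are adjacent iff `v` is an endpoint of `e`; there are no
other adjacencies. -/
def subdivRel {V : Type*} (G : SimpleGraph V) :
    (V ⊕ ↥G.edgeSet) → (V ⊕ ↥G.edgeSet) → Prop
  | Sum.inl v, Sum.inr e => v ∈ (e : Sym2 V)
  | _, _ => False

/-- The 1-subdivision `G'` of `G`, on vertex set `V ⊎ E`. -/
def subdivG {V : Type*} (G : SimpleGraph V) : SimpleGraph (V ⊕ ↥G.edgeSet) :=
  SimpleGraph.fromRel (subdivRel G)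

theorem subdivG_adj_inl_inr {V : Type*} (G : SimpleGraph V) (v : V) (e : G.edgeSet) :
    (subdivG G).Adj (Sum.inl v) (Sum.inr e) ↔ v ∈ (e : Sym2 V) := by
  simp [subdivG, SimpleGraph.fromRel_adj, subdivRel]

theorem not_subdivG_adj_inl_inl {V : Type*} (G : SimpleGraph V) (u v : V) :
    ¬ (subdivG G).Adj (Sum.inl u) (Sum.inl v) := by
  simp [subdivG, SimpleGraph.fromRel_adj, subdivRel]

theorem not_subdivG_adj_inr_inr {V : Type*} (G : SimpleGraph V) (e f : G.edgeSet) :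
    ¬ (subdivG G).Adj (Sum.inr e) (Sum.inr f) := by
  simp [subdivG, SimpleGraph.fromRel_adj, subdivRel]

/-- If every deleted edge of `G` has a deleted incidence in the subdivision, then walks in what
remains of the subdivision project to walks of at most half the length. -/
theorem exists_walk_of_subdivG_walk {V : Type*} (G : SimpleGraph V) (S : Set (Sym2 V))
    (S' : Set (Sym2 (V ⊕ ↥G.edgeSet)))
    (h : ∀ e : G.edgeSet, (e : Sym2 V) ∈ S →
      ∃ v ∈ (e : Sym2 V), s(Sum.inl v, Sum.inr e) ∈ S') {t : V} :
    ∀ (n : ℕ) (u : V) (p : ((subdivG G).deleteEdges S').Walk (Sum.inl u) (Sum.inl t)),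
      p.length ≤ n → ∃ q : (G.deleteEdges S).Walk u t, 2 * q.length ≤ p.length := by
  intro n
  induction n using Nat.strong_induction_on with
  | _ n ih =>
  intro u p hp
  cases p with
  | nil => exact ⟨.nil, by simp⟩
  | @cons _ x _ h₁ p =>
    rw [SimpleGraph.deleteEdges_adj] at h₁
    rcases x with x | e
    · exact absurd h₁.1 (not_subdivG_adj_inl_inl G _ _)
    cases p with
    | @cons _ y _ h₂ p =>
      rw [SimpleGraph.deleteEdges_adj] at h₂
      rcases y with w | f
      swap
      · exact absurd h₂.1 (not_subdivG_adj_inr_inr G _ _)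
      simp only [SimpleGraph.Walk.length_cons] at hp ⊢
      obtain ⟨q, hq⟩ := ih (n - 1) (by omega) w p (by omega)
      by_cases huw : u = w
      · subst huw
        exact ⟨q, by omega⟩
      have hu := (subdivG_adj_inl_inr G u e).1 h₁.1
      have hw := (subdivG_adj_inl_inr G w e).1 h₂.1.symm
      have he : (e : Sym2 V) = s(u, w) := (Sym2.mem_and_mem_iff huw).1 ⟨hu, hw⟩
      have hadj : (G.deleteEdges S).Adj u w := by
        rw [SimpleGraph.deleteEdges_adj]
        refine ⟨by rw [← SimpleGraph.mem_edgeSet, ← he]; exact e.2, fun hS => ?_⟩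
        obtain ⟨v, hv, hv'⟩ := h e (he ▸ hS)
        rw [he, Sym2.mem_iff] at hv
        rcases hv with rfl | rfl
        · exact h₁.2 hv'
        · exact h₂.2 (Sym2.eq_swap ▸ hv')
      exact ⟨.cons hadj q, by simp only [SimpleGraph.Walk.length_cons]; omega⟩

/-- If every edge of `G` with a deleted incidence in the subdivision is deleted, then walks in what
remains of `G` lift to walks of twice the length. -/
theorem exists_subdivG_walk_of_walk {V : Type*} (G : SimpleGraph V) (S : Set (Sym2 V))
    (S' : Set (Sym2 (V ⊕ ↥G.edgeSet)))
    (h : ∀ (e : G.edgeSet) (v : V), s(Sum.inl v, Sum.inr e) ∈ S' → (e : Sym2 V) ∈ S)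
    {u t : V} (p : (G.deleteEdges S).Walk u t) :
    ∃ q : ((subdivG G).deleteEdges S').Walk (Sum.inl u) (Sum.inl t),
      q.length = 2 * p.length := by
  induction p with
  | nil => exact ⟨.nil, by simp⟩
  | @cons u w _ huw p ih =>
    obtain ⟨q, hq⟩ := ih
    rw [SimpleGraph.deleteEdges_adj] at huw
    have hadj : ∀ v ∈ s(u, w), ((subdivG G).deleteEdges S').Adj (Sum.inl v)
        (Sum.inr ⟨s(u, w), huw.1⟩) := fun v hv => by
      rw [SimpleGraph.deleteEdges_adj, subdivG_adj_inl_inr]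
      exact ⟨hv, fun hS => huw.2 (h _ _ hS)⟩
    refine ⟨.cons (hadj u (Sym2.mem_mk_left _ _)) (.cons (hadj w (Sym2.mem_mk_right _ _)).symm q),
      ?_⟩
    simp only [SimpleGraph.Walk.length_cons]
    omega

/-- **Correctness of the subdivision reduction (unit lengths).**
Let `G` be a finite simple graph, `s t` vertices, and `G'` the 1-subdivision
of `G`. Then for all `k, ℓ ∈ ℕ`: there is `S ⊆ E(G)` with `|S| ≤ k` and
`dist_{G−S}(s,t) ≥ ℓ` iff there is `S' ⊆ E(G')` with `|S'| ≤ k` and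
`dist_{G'−S'}(s,t) ≥ 2ℓ` (distance `+∞` when disconnected, via `edist`). -/
theorem stmt9 {V : Type*} [Fintype V] (G : SimpleGraph V) (s t : V) (k ℓ : ℕ) :
    (∃ S : Finset (Sym2 V), ↑S ⊆ G.edgeSet ∧ S.card ≤ k ∧
        (ℓ : ℕ∞) ≤ (G.deleteEdges ↑S).edist s t) ↔
    (∃ S' : Finset (Sym2 (V ⊕ ↥G.edgeSet)),
        ↑S' ⊆ (subdivG G).edgeSet ∧ S'.card ≤ k ∧
        ((2 * ℓ : ℕ) : ℕ∞) ≤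
          ((subdivG G).deleteEdges ↑S').edist (Sum.inl s) (Sum.inl t)) := by
  classical
  constructor
  · rintro ⟨S, hSG, hSk, hS⟩
    refine ⟨S.attach.image fun e => s(Sum.inl (Quot.out e.1).1, Sum.inr ⟨e.1, hSG e.2⟩),
      ?_, (Finset.card_image_le.trans_eq S.card_attach).trans hSk, le_iInf fun p => ?_⟩
    · intro x hx
      obtain ⟨e, -, rfl⟩ := Finset.mem_image.1 (Finset.mem_coe.1 hx)
      exact (subdivG_adj_inl_inr G _ _).2 (Sym2.out_fst_mem _)
    · obtain ⟨q, hq⟩ := exists_walk_of_subdivG_walk G (S : Set (Sym2 V)) _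
        (fun e he => ⟨(Quot.out e.1).1, Sym2.out_fst_mem _,
          Finset.mem_coe.2 (Finset.mem_image.2 ⟨⟨e.1, he⟩, Finset.mem_attach _ _, rfl⟩)⟩)
        p.length s p le_rfl
      have hle : ℓ ≤ q.length := by exact_mod_cast hS.trans q.edist_le
      exact_mod_cast (Nat.mul_le_mul_left 2 hle).trans hq
  · rintro ⟨S', -, hSk, hS⟩
    let S : Finset (Sym2 V) :=
      {e | ∃ (he : e ∈ G.edgeSet) (v : V), s(Sum.inl v, Sum.inr ⟨e, he⟩) ∈ S'}
    have hmem : ∀ e, e ∈ S ↔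
        ∃ (he : e ∈ G.edgeSet) (v : V), s(Sum.inl v, Sum.inr ⟨e, he⟩) ∈ S' := by
      simp [S]
    refine ⟨S, fun e he => ((hmem e).1 he).1, le_trans ?_ hSk, le_iInf fun p => ?_⟩
    · choose hG v hv using fun e : S => (hmem e).1 e.2
      rw [← S.card_attach]
      refine Finset.card_le_card_of_injOn (fun e => s(Sum.inl (v e), Sum.inr ⟨e.1, hG e⟩))
        (fun e _ => hv e) fun e _ f _ hef => ?_
      have hi : (⟨e.1, hG e⟩ : G.edgeSet) = ⟨f.1, hG f⟩ := by
        have h₁ : s(Sum.inl (v e), Sum.inr (⟨e.1, hG e⟩ : G.edgeSet)) =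
            s(Sum.inl (v f), Sum.inr ⟨f.1, hG f⟩) := hef
        have hm := Sym2.mem_mk_right (Sum.inl (v e)) (Sum.inr (⟨e.1, hG e⟩ : G.edgeSet))
        rw [h₁, Sym2.mem_iff] at hm
        exact hm.elim (fun h => nomatch h) Sum.inr.inj
      exact Subtype.ext (Subtype.mk.inj hi)
    · obtain ⟨q, hq⟩ := exists_subdivG_walk_of_walk G (S : Set (Sym2 V)) (S' : Set _)
        (fun e v he => (hmem _).2 ⟨e.2, v, he⟩) p
      have hle : 2 * ℓ ≤ q.length := by exact_mod_cast hS.trans q.edist_le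
      have : ℓ ≤ p.length := by omega
      exact_mod_cast this
end
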